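/- Fix real numbers α and θ with 0 < α < 1 and θ > −α, fix n ∈ ℕ and k ∈ ℕ₀, fix c ≥ 0, and let (ω_m)_{m ∈ ℕ} be a sequence in ℕ₀ with ω_m/m^{α} → c as m → ∞. Then lim_{m→∞} d_{n,k}^{m,ω_m} / d^{m,ω_m} = V^{IBP,α,θ}_{n,k}(γ), where γ = c α Γ(α+θ)/Γ(θ+1). (Proposition 2.3(a).) -/

import Mathlib

open scoped BigOperators
open Filter

/-- Rising factorial `(x)_{j↑} = x(x+1)⋯(x+j-1)`. -/
noncomputable def risingFac (x : ℝ) (j : ℕ) : ℝ :=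
  ∏ i ∈ Finset.range j, (x + i)

/-- Falling factorial `(x)_{j↓} = x(x-1)⋯(x-j+1)`. -/
noncomputable def fallingFac (x : ℝ) (j : ℕ) : ℝ :=
  ∏ i ∈ Finset.range j, (x - i)

/-- `S_{n,m} = Σ_{i=1}^{m−n} (α+θ)_{m−i↑} (θ+m−1)_{i−1↓}`. -/
noncomputable def Scot (α θ : ℝ) (n m : ℕ) : ℝ :=
  ∑ i ∈ Finset.Icc 1 (m - n),
    risingFac (α + θ) (m - i) * fallingFac (θ + (m : ℝ) - 1) (i - 1)

/-- `d_{n,k}^{m,l} = C(l,k) ((θ+n)_{m−n↑})^k (S_{n,m})^{l−k}` (equal to `0` when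
`k > l`, since then the binomial coefficient vanishes). -/
noncomputable def dcot (α θ : ℝ) (n k m l : ℕ) : ℝ :=
  (Nat.choose l k : ℝ) * (risingFac (θ + (n : ℝ)) (m - n)) ^ k *
    (Scot α θ n m) ^ (l - k)

/-- `d^{m,l} = ((θ+1)_{m−1↑} + S_{1,m})^l`. -/
noncomputable def dtot (α θ : ℝ) (m l : ℕ) : ℝ :=
  (risingFac (θ + 1) (m - 1) + Scot α θ 1 m) ^ l

/-- Indian Buffet Process weights `V^{IBP,α,θ}_{n,k}(γ)`. -/
noncomputable def VIBP (α θ γ : ℝ) (n k : ℕ) : ℝ :=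
  (1 / (Nat.factorial k : ℝ)) * (γ / risingFac (θ + 1) (n - 1)) ^ k *
    Real.exp (-(∑ i ∈ Finset.Icc 1 n,
      γ * risingFac (α + θ) (i - 1) / risingFac (1 + θ) (i - 1)))

lemma risingFac_pos {x : ℝ} (hx : 0 < x) (j : ℕ) : 0 < risingFac x j :=
  Finset.prod_pos fun i _ => by positivity

lemma risingFac_succ (x : ℝ) (j : ℕ) : risingFac x (j + 1) = risingFac x j * (x + j) :=
  Finset.prod_range_succ _ _

lemma risingFac_add (x : ℝ) (i j : ℕ) :
    risingFac x (i + j) = risingFac x i * risingFac (x + i) j := by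
  simp [risingFac, Finset.prod_range_add, add_assoc]

lemma fallingFac_eq_risingFac (x : ℝ) (j : ℕ) : fallingFac (x + j - 1) j = risingFac x j := by
  rw [fallingFac, risingFac, ← Finset.prod_range_reflect]
  refine Finset.prod_congr rfl fun i hi => ?_
  have hi : i + 1 ≤ j := Finset.mem_range.1 hi
  rw [Nat.sub_sub, add_comm 1 i, Nat.cast_sub hi]
  push_cast
  ring

/-- The normalized partial sums `∑_{j < m} (α+θ)_{j↑} / (θ+1)_{j↑}`. -/
noncomputable def ratioSum (α θ : ℝ) (m : ℕ) : ℝ :=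
  ∑ j ∈ Finset.range m, risingFac (α + θ) j / risingFac (θ + 1) j

lemma ratioSum_eq {α θ : ℝ} (hα : α ≠ 0) (hθ : -1 < θ) (m : ℕ) :
    ratioSum α θ m =
      (risingFac (α + θ) m / risingFac (θ + 1) m * (θ + m) - θ) / α := by
  induction m with
  | zero => simp [ratioSum, risingFac]
  | succ m ih =>
    rw [ratioSum, Finset.sum_range_succ, ← ratioSum, ih, risingFac_succ, risingFac_succ]
    have h1 := (risingFac_pos (show 0 < θ + 1 by linarith) m).ne'
    have h2 : θ + 1 + m ≠ 0 := by
      have : (0 : ℝ) ≤ m := m.cast_nonneg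
      linarith
    push_cast
    field_simp
    ring

lemma Scot_eq {α θ : ℝ} (hθ : -1 < θ) {n m : ℕ} (hnm : n ≤ m) :
    Scot α θ n m = risingFac (θ + 1) (m - 1) * (ratioSum α θ m - ratioSum α θ n) := by
  rw [ratioSum, ratioSum, ← Finset.sum_Ico_eq_sub _ hnm, Finset.mul_sum, Scot]
  refine Finset.sum_nbij' (fun i => m - i) (fun j => m - j) ?_ ?_ ?_ ?_ ?_
  · intro i hi
    simp only [Finset.mem_Icc, Finset.mem_Ico] at *
    omega
  · intro i hi
    simp only [Finset.mem_Icc, Finset.mem_Ico] at *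
    omega
  · intro i hi
    simp only [Finset.mem_Icc] at *
    omega
  · intro i hi
    simp only [Finset.mem_Ico] at *
    omega
  · intro i hi
    obtain ⟨hi1, hi2⟩ := Finset.mem_Icc.1 hi
    obtain ⟨p, rfl⟩ := Nat.exists_eq_add_of_le' hi1
    obtain ⟨j, rfl⟩ : ∃ j, m = j + (p + 1) := ⟨m - (p + 1), by omega⟩
    have h1 := (risingFac_pos (show 0 < θ + 1 by linarith) j).ne'
    have h2 : θ + ((j + (p + 1) : ℕ) : ℝ) - 1 = (θ + 1 + j) + p - 1 := by
      push_cast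
      ring
    rw [h2, Nat.add_sub_cancel, Nat.add_sub_cancel, fallingFac_eq_risingFac, ← add_assoc,
      Nat.add_sub_cancel, risingFac_add]
    field_simp

lemma dtot_eq {α θ : ℝ} (hθ : -1 < θ) {m : ℕ} (hm : 1 ≤ m) (l : ℕ) :
    dtot α θ m l = (risingFac (θ + 1) (m - 1) * ratioSum α θ m) ^ l := by
  rw [dtot, Scot_eq hθ hm]
  congr 1
  simp only [ratioSum, Finset.sum_range_one, risingFac, Finset.prod_range_zero]
  ring

lemma dcot_div_dtot {α θ : ℝ} (hθ : -1 < θ) {n m : ℕ} (hn : 1 ≤ n) (hnm : n ≤ m) (k l : ℕ)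
    (hm0 : ratioSum α θ m ≠ 0) (h1 : 1 - ratioSum α θ n / ratioSum α θ m ≠ 0) :
    dcot α θ n k m l / dtot α θ m l =
      (l.choose k : ℝ) / ratioSum α θ m ^ k * (1 / risingFac (θ + 1) (n - 1)) ^ k *
        ((1 - ratioSum α θ n / ratioSum α θ m) ^ l /
          (1 - ratioSum α θ n / ratioSum α θ m) ^ k) := by
  rcases lt_or_ge l k with hlk | hkl
  · simp [dcot, Nat.choose_eq_zero_of_lt hlk]
  obtain ⟨p, rfl⟩ := Nat.exists_eq_add_of_le hkl
  have hR : risingFac (θ + 1) (m - 1) =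
      risingFac (θ + 1) (n - 1) * risingFac (θ + n) (m - n) := by
    have h : m - 1 = (n - 1) + (m - n) := by omega
    rw [h, risingFac_add, Nat.cast_sub hn]
    congr 2
    push_cast
    ring
  have hθ1 : 0 < θ + 1 := by linarith
  have hA := (risingFac_pos hθ1 (n - 1)).ne'
  have hB := (risingFac_pos hθ1 (m - 1)).ne'
  have hC : risingFac (θ + n) (m - n) ≠ 0 := fun h => hB (by rw [hR, h, mul_zero])
  have hdiff : ratioSum α θ m - ratioSum α θ n =
      ratioSum α θ m * (1 - ratioSum α θ n / ratioSum α θ m) := by field_simp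
  rw [dcot, dtot_eq hθ (hn.trans hnm), Scot_eq hθ hnm, Nat.add_sub_cancel_left, hdiff, hR]
  generalize 1 - ratioSum α θ n / ratioSum α θ m = x at h1 ⊢
  simp only [mul_pow, pow_add, div_pow, one_pow]
  field_simp

lemma tendsto_natCast_add_div (a : ℝ) :
    Tendsto (fun m : ℕ => (a + m) / (m : ℝ)) atTop (nhds 1) := by
  have h : Tendsto (fun m : ℕ => a / (m : ℝ) + 1) atTop (nhds (0 + 1)) :=
    (tendsto_const_div_atTop_nhds_zero_nat a).add_const 1
  rw [zero_add] at h
  refine h.congr' ?_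
  filter_upwards [eventually_ne_atTop 0] with m hm
  have : (m : ℝ) ≠ 0 := Nat.cast_ne_zero.2 hm
  field_simp

lemma tendsto_ratioSum_div_rpow {α θ : ℝ} (hα0 : 0 < α) (hθ1 : -1 < θ) (hθ : -α < θ) :
    Tendsto (fun m : ℕ => ratioSum α θ m / (m : ℝ) ^ α) atTop
      (nhds (Real.Gamma (θ + 1) / (α * Real.Gamma (α + θ)))) := by
  have hb : 0 < α + θ := by linarith
  have hc : 0 < θ + 1 := by linarith
  have hG := (Real.Gamma_pos_of_pos hb).ne'
  have hz : Tendsto (fun m : ℕ => θ / (m : ℝ) ^ α) atTop (nhds 0) :=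
    ((tendsto_rpow_atTop hα0).comp tendsto_natCast_atTop_atTop).const_div_atTop θ
  have hmain := ((((Real.GammaSeq_tendsto_Gamma (θ + 1)).div
    (Real.GammaSeq_tendsto_Gamma (α + θ)) hG).mul
    (((tendsto_natCast_add_div (θ + 1)).div (tendsto_natCast_add_div (α + θ)) one_ne_zero).mul
      (tendsto_natCast_add_div θ))).sub hz).div_const α
  convert! hmain.congr' ?_ using 2
  · field_simp
    ring
  filter_upwards [eventually_ne_atTop 0] with m hm
  have hm' : (0 : ℝ) < m := by positivity
  have hseq (s : ℝ) : Real.GammaSeq s m = (m : ℝ) ^ s * m.factorial / (risingFac s m * (s + m)) := by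
    rw [← risingFac_succ]
    rfl
  have e1 : (m : ℝ) ^ (θ + 1) = (m : ℝ) ^ θ * m := by rw [Real.rpow_add hm', Real.rpow_one]
  have e2 : (m : ℝ) ^ (α + θ) = (m : ℝ) ^ α * (m : ℝ) ^ θ := Real.rpow_add hm' _ _
  have p1 := (risingFac_pos hb m).ne'
  have p2 := (risingFac_pos hc m).ne'
  have p3 : α + θ + m ≠ 0 := by positivity
  have p4 : θ + 1 + m ≠ 0 := by positivity
  have p5 := (Real.rpow_pos_of_pos hm' α).ne'
  have p6 := (Real.rpow_pos_of_pos hm' θ).ne'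
  have p7 : (m.factorial : ℝ) ≠ 0 := by positivity
  simp only [Pi.div_apply]
  rw [ratioSum_eq hα0.ne' hθ1, hseq, hseq, e1, e2]
  field_simp

lemma tendsto_choose_div_pow {l : ℕ → ℕ} {T : ℕ → ℝ} {γ : ℝ} (hT : Tendsto T atTop atTop)
    (h : Tendsto (fun m => (l m : ℝ) / T m) atTop (nhds γ)) (k : ℕ) :
    Tendsto (fun m => ((l m).choose k : ℝ) / T m ^ k) atTop
      (nhds (γ ^ k / k.factorial)) := by
  have hprod : Tendsto (fun m => ∏ i ∈ Finset.range k, ((l m : ℝ) / T m - i / T m)) atTop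
      (nhds (∏ _i ∈ Finset.range k, (γ - 0))) :=
    tendsto_finsetProd _ fun i _ => h.sub (hT.const_div_atTop (i : ℝ))
  simp only [sub_zero, Finset.prod_const, Finset.card_range] at hprod
  refine (hprod.div_const (k.factorial : ℝ)).congr fun m => ?_
  simp only [← sub_div, Finset.prod_div_distrib, Finset.prod_const, Finset.card_range]
  rw [← descPochhammer_eval_eq_prod_range, descPochhammer_eval_eq_descFactorial,
    Nat.descFactorial_eq_factorial_mul_choose]
  push_cast
  field_simp

lemma tendsto_one_sub_pow_exp {l : ℕ → ℕ} {x : ℕ → ℝ} {t : ℝ} (hx : Tendsto x atTop (nhds 0))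
    (h : Tendsto (fun m => (l m : ℝ) * x m) atTop (nhds t)) :
    Tendsto (fun m => (1 - x m) ^ l m) atTop (nhds (Real.exp (-t))) := by
  have hlow : Tendsto (fun m => Real.exp (-(l m * x m / (1 - x m)))) atTop
      (nhds (Real.exp (-t))) := by
    have := ((h.div (hx.const_sub 1) (by norm_num)).neg).rexp
    simpa using this
  refine tendsto_of_tendsto_of_tendsto_of_le_of_le' hlow h.neg.rexp ?_ ?_
  · filter_upwards [hx.eventually_lt_const (show (0 : ℝ) < 1 by norm_num)] with m hm
    have hpos : 0 < 1 - x m := by linarith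
    have hle : Real.exp (-(x m / (1 - x m))) ≤ 1 - x m := by
      rw [Real.exp_neg]
      refine inv_le_of_inv_le₀ hpos ?_
      calc (1 - x m)⁻¹ = x m / (1 - x m) + 1 := by field_simp; ring
        _ ≤ _ := Real.add_one_le_exp _
    calc Real.exp (-(l m * x m / (1 - x m))) = Real.exp (-(x m / (1 - x m))) ^ l m := by
          rw [← Real.exp_nat_mul]
          ring_nf
      _ ≤ _ := pow_le_pow_left₀ (Real.exp_pos _).le hle _
  · filter_upwards [hx.eventually_lt_const (show (0 : ℝ) < 1 by norm_num)] with m hm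
    calc (1 - x m) ^ l m ≤ Real.exp (-x m) ^ l m :=
          pow_le_pow_left₀ (by linarith) (Real.one_sub_le_exp_neg _) _
      _ = _ := by
          rw [← Real.exp_nat_mul]
          ring_nf

lemma VIBP_eq (α θ γ : ℝ) (n k : ℕ) :
    VIBP α θ γ n k = γ ^ k / k.factorial * (1 / risingFac (θ + 1) (n - 1)) ^ k *
      Real.exp (-(γ * ratioSum α θ n)) := by
  have hsum : ∑ i ∈ Finset.Icc 1 n,
      γ * risingFac (α + θ) (i - 1) / risingFac (1 + θ) (i - 1) = γ * ratioSum α θ n := by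
    rw [ratioSum, Finset.mul_sum, Finset.range_eq_Ico,
      ← Finset.Ico_add_one_right_eq_Icc, Finset.sum_Ico_eq_sum_range, add_tsub_cancel_right,
      Finset.range_eq_Ico]
    refine Finset.sum_congr rfl fun i _ => ?_
    rw [add_tsub_cancel_left, add_comm 1 θ, mul_div_assoc]
  rw [VIBP, hsum, div_pow, div_pow]
  ring

/-- Proposition 2.3(a). -/
theorem stmt_16
    (α θ : ℝ) (hα0 : 0 < α) (hα1 : α < 1) (hθ : -α < θ)
    (n : ℕ) (hn : 1 ≤ n) (k : ℕ) (c : ℝ) (hc : 0 ≤ c)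
    (ω : ℕ → ℕ)
    (hω : Tendsto (fun m : ℕ => (ω m : ℝ) / (m : ℝ) ^ α) atTop (nhds c)) :
    Tendsto (fun m : ℕ => dcot α θ n k m (ω m) / dtot α θ m (ω m)) atTop
      (nhds (VIBP α θ (c * α * Real.Gamma (α + θ) / Real.Gamma (θ + 1)) n k)) := by
  have hθ1 : -1 < θ := by linarith
  have hb := Real.Gamma_pos_of_pos (show 0 < α + θ by linarith)
  have hg := Real.Gamma_pos_of_pos (show 0 < θ + 1 by linarith)
  set γ := c * α * Real.Gamma (α + θ) / Real.Gamma (θ + 1) with hγ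
  have hpow : Tendsto (fun m : ℕ => (m : ℝ) ^ α) atTop atTop :=
    (tendsto_rpow_atTop hα0).comp tendsto_natCast_atTop_atTop
  have hratio := tendsto_ratioSum_div_rpow hα0 hθ1 hθ
  have hL : 0 < Real.Gamma (θ + 1) / (α * Real.Gamma (α + θ)) := by positivity
  have hT : Tendsto (ratioSum α θ) atTop atTop := by
    refine (hratio.pos_mul_atTop hL hpow).congr' ?_
    filter_upwards [hpow.eventually_gt_atTop 0] with m hm
    exact div_mul_cancel₀ _ hm.ne'
  have hl : Tendsto (fun m => (ω m : ℝ) / ratioSum α θ m) atTop (nhds γ) := by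
    convert! (hω.div hratio hL.ne').congr' ?_ using 2
    · rw [hγ]
      field_simp
    filter_upwards [hpow.eventually_gt_atTop 0] with m hm
    exact div_div_div_cancel_right₀ hm.ne' _ _
  have hx : Tendsto (fun m => ratioSum α θ n / ratioSum α θ m) atTop (nhds 0) :=
    hT.const_div_atTop _
  have hlx : Tendsto (fun m => (ω m : ℝ) * (ratioSum α θ n / ratioSum α θ m)) atTop
      (nhds (γ * ratioSum α θ n)) :=
    (hl.mul_const _).congr fun m => by ring
  have hk : Tendsto (fun m => (1 - ratioSum α θ n / ratioSum α θ m) ^ k) atTop (nhds 1) := by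
    simpa using (hx.const_sub 1).pow k
  have hlim := ((tendsto_choose_div_pow hT hl k).mul_const
    ((1 / risingFac (θ + 1) (n - 1)) ^ k)).mul
    ((tendsto_one_sub_pow_exp hx hlx).div hk one_ne_zero)
  rw [div_one, ← VIBP_eq] at hlim
  refine hlim.congr' ?_
  filter_upwards [eventually_ge_atTop n, hT.eventually_gt_atTop 0,
    hx.eventually_lt_const (show (0 : ℝ) < 1 by norm_num)] with m hnm hm0 hm1
  exact (dcot_div_dtot hθ1 hn hnm k (ω m) hm0.ne' (by linarith)).symm
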